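/- Let p ≥ 3 be a prime, F the finite field with p² elements, K an algebraic closure of F, and identify F with its image in K. Let r, s, t ∈ K satisfy r² ≠ 4, s² ≠ 4, t² ≠ 4, r² + s² + t² − rst − 4 ≠ 0, rt − 2s ≠ 0, sr − 2t ≠ 0 and ts − 2r ≠ 0. Fix α, β, γ ∈ K with α² = r² − 4, β² = s² − 4, γ² = t² − 4, assume (rt − 2s) + γα ≠ 0, (sr − 2t) + αβ ≠ 0, (ts − 2r) + βγ ≠ 0, and define λ₁ = ((rt−2s) − γα)/((rt−2s) + γα), λ₂ = ((sr−2t) − αβ)/((sr−2t) + αβ), λ₃ = ((ts−2r) − βγ)/((ts−2r) + βγ). If for each i ∈ {1, 2, 3} there exists cᵢ ∈ F with cᵢ⁴ = λᵢ, then r, s and t all lie in F. -/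

import Mathlib

/-- The part of the spherical dual law of cosines that recovers one coefficient. -/
theorem ciani_aux {K : Type*} [Field K] (S : Subfield K) (h20 : (2 : K) ≠ 0)
    (r s t α β γ l1 l2 l3 c2 c3 : K)
    (hr : r ^ 2 ≠ 4) (hs : s ^ 2 ≠ 4) (ht : t ^ 2 ≠ 4)
    (hΔ : r ^ 2 + s ^ 2 + t ^ 2 - r * s * t - 4 ≠ 0)
    (hα : α ^ 2 = r ^ 2 - 4) (hβ : β ^ 2 = s ^ 2 - 4) (hγ : γ ^ 2 = t ^ 2 - 4)
    (hd1 : (r * t - 2 * s) + γ * α ≠ 0)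
    (hd2 : (s * r - 2 * t) + α * β ≠ 0)
    (hd3 : (t * s - 2 * r) + β * γ ≠ 0)
    (hl1 : l1 = ((r * t - 2 * s) - γ * α) / ((r * t - 2 * s) + γ * α))
    (hl2 : l2 = ((s * r - 2 * t) - α * β) / ((s * r - 2 * t) + α * β))
    (hl3 : l3 = ((t * s - 2 * r) - β * γ) / ((t * s - 2 * r) + β * γ))
    (m1 : l1 ∈ S) (m2 : c2 ∈ S) (m3 : c3 ∈ S) (e2 : c2 ^ 4 = l2) (e3 : c3 ^ 4 = l3) :
    s ∈ S := by
  have hα0 : α ≠ 0 := by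
    rintro rfl; exact hr (by linear_combination -hα)
  have hβ0 : β ≠ 0 := by
    rintro rfl; exact hs (by linear_combination -hβ)
  have hγ0 : γ ≠ 0 := by
    rintro rfl; exact ht (by linear_combination -hγ)
  have key : ∀ n d l : K, d ≠ 0 → n + d ≠ 0 → l = (n - d) / (n + d) →
      1 - l ≠ 0 ∧ (1 + l) / (1 - l) = n / d ∧ 4 * l / (1 - l) ^ 2 = (n ^ 2 - d ^ 2) / d ^ 2 := by
    intro n d l hd hnd hl
    have e : 1 - l = 2 * d / (n + d) := by rw [hl]; field_simp; ring
    have e' : 1 + l = 2 * n / (n + d) := by rw [hl]; field_simp; ring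
    refine ⟨by rw [e]; exact div_ne_zero (mul_ne_zero h20 hd) hnd, ?_, ?_⟩
    · rw [e, e']; field_simp
    · rw [e, hl]; field_simp; ring
  obtain ⟨z1, a1, -⟩ := key _ _ _ (mul_ne_zero hγ0 hα0) hd1 hl1
  obtain ⟨z2, a2, b2⟩ := key _ _ _ (mul_ne_zero hα0 hβ0) hd2 hl2
  obtain ⟨z3, a3, b3⟩ := key _ _ _ (mul_ne_zero hβ0 hγ0) hd3 hl3
  have m2' : l2 ∈ S := e2 ▸ S.pow_mem m2 4
  have m3' : l3 ∈ S := e3 ▸ S.pow_mem m3 4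
  have two : (2 : K) ∈ S := by simp
  set Δ := r ^ 2 + s ^ 2 + t ^ 2 - r * s * t - 4 with hΔd
  have n2 : (s * r - 2 * t) ^ 2 - (α * β) ^ 2 = 4 * Δ := by
    rw [mul_pow, hα, hβ, hΔd]; ring
  have n3 : (t * s - 2 * r) ^ 2 - (β * γ) ^ 2 = 4 * Δ := by
    rw [mul_pow, hβ, hγ, hΔd]; ring
  rw [n2] at b2
  rw [n3] at b3
  have sum : (1 + l1) / (1 - l1) + (1 + l2) / (1 - l2) * ((1 + l3) / (1 - l3))
      = -2 * s * Δ / (α * β ^ 2 * γ) := by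
    rw [a1, a2, a3]
    field_simp
    rw [hβ, hΔd]; ring
  set T := (1 + l1) / (1 - l1) + (1 + l2) / (1 - l2) * ((1 + l3) / (1 - l3)) with hT
  have mT : T ∈ S :=
    S.add_mem (S.div_mem (S.add_mem S.one_mem m1) (S.sub_mem S.one_mem m1))
      (S.mul_mem (S.div_mem (S.add_mem S.one_mem m2') (S.sub_mem S.one_mem m2'))
        (S.div_mem (S.add_mem S.one_mem m3') (S.sub_mem S.one_mem m3')))
  set U := c2 ^ 2 * c3 ^ 2 * 2 / ((1 - l2) * (1 - l3)) with hU
  have mU : U ∈ S :=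
    S.div_mem (S.mul_mem (S.mul_mem (S.pow_mem m2 2) (S.pow_mem m3 2)) two)
      (S.mul_mem (S.sub_mem S.one_mem m2') (S.sub_mem S.one_mem m3'))
  have h40 : (4 : K) ≠ 0 := by
    have := mul_ne_zero h20 h20
    norm_num at this; exact this
  have U2 : U ^ 2 = (2 * Δ / (α * β ^ 2 * γ)) ^ 2 := by
    have : 4 * U ^ 2 = 4 * l2 / (1 - l2) ^ 2 * (4 * l3 / (1 - l3) ^ 2) := by
      rw [hU, ← e2, ← e3]
      rw [← e2] at z2
      rw [← e3] at z3
      field_simp; ring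
    apply mul_left_cancel₀ h40
    rw [this, b2, b3]; field_simp; ring
  have hU0 : U ≠ 0 := by
    intro h
    rw [h] at U2
    have : 2 * Δ / (α * β ^ 2 * γ) ≠ 0 := by
      apply div_ne_zero (mul_ne_zero h20 hΔ)
      exact mul_ne_zero (mul_ne_zero hα0 (pow_ne_zero 2 hβ0)) hγ0
    exact pow_ne_zero 2 this (by rw [← U2]; ring)
  have sq : s ^ 2 = (T / U) ^ 2 := by
    rw [div_pow, eq_div_iff (pow_ne_zero 2 hU0), U2, sum]; ring
  rcases sq_eq_sq_iff_eq_or_eq_neg.mp sq with h | h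
  · rw [h]; exact S.div_mem mT mU
  · rw [h]; exact S.neg_mem (S.div_mem mT mU)

/-- First assertion of the main theorem: if the Legendre parameters of the
three quotient elliptic curves of the Ciani curve are fourth powers in
`F = 𝔽_{p²}` (viewed inside an algebraic closure `K` of `F`), then the
coefficients `r`, `s`, `t` lie in `F`. -/
theorem ciani_coefficients_in_Fp2 (p : ℕ) [Fact p.Prime] (hp : 3 ≤ p)
    (F : Type*) [Field F] [Fintype F] (hF : Fintype.card F = p ^ 2)
    (K : Type*) [Field K] [Algebra F K] [IsAlgClosure F K]
    (r s t α β γ l1 l2 l3 : K)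
    (hr : r ^ 2 ≠ 4) (hs : s ^ 2 ≠ 4) (ht : t ^ 2 ≠ 4)
    (hΔ : r ^ 2 + s ^ 2 + t ^ 2 - r * s * t - 4 ≠ 0)
    (h1 : r * t - 2 * s ≠ 0) (h2 : s * r - 2 * t ≠ 0) (h3 : t * s - 2 * r ≠ 0)
    (hα : α ^ 2 = r ^ 2 - 4) (hβ : β ^ 2 = s ^ 2 - 4) (hγ : γ ^ 2 = t ^ 2 - 4)
    (hd1 : (r * t - 2 * s) + γ * α ≠ 0)
    (hd2 : (s * r - 2 * t) + α * β ≠ 0)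
    (hd3 : (t * s - 2 * r) + β * γ ≠ 0)
    (hl1 : l1 = ((r * t - 2 * s) - γ * α) / ((r * t - 2 * s) + γ * α))
    (hl2 : l2 = ((s * r - 2 * t) - α * β) / ((s * r - 2 * t) + α * β))
    (hl3 : l3 = ((t * s - 2 * r) - β * γ) / ((t * s - 2 * r) + β * γ))
    (hc1 : ∃ c : F, (algebraMap F K c) ^ 4 = l1)
    (hc2 : ∃ c : F, (algebraMap F K c) ^ 4 = l2)
    (hc3 : ∃ c : F, (algebraMap F K c) ^ 4 = l3) :
    r ∈ Set.range (algebraMap F K) ∧ s ∈ Set.range (algebraMap F K) ∧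
      t ∈ Set.range (algebraMap F K) := by
  obtain ⟨c1, e1⟩ := hc1
  obtain ⟨c2, e2⟩ := hc2
  obtain ⟨c3, e3⟩ := hc3
  have h2F : (2 : F) ≠ 0 := by
    intro h
    have hc : ((p ^ 2 : ℕ) : F) = 0 := by rw [← hF]; exact FiniteField.cast_card_eq_zero F
    have hodd : Odd (p ^ 2) := ((Fact.out : p.Prime).odd_of_ne_two (by omega)).pow
    obtain ⟨k, hk⟩ := hodd
    rw [hk] at hc
    push_cast at hc
    rw [h] at hc
    simp at hc
  have h20 : (2 : K) ≠ 0 := by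
    intro h
    apply h2F
    apply (algebraMap F K).injective
    rw [map_ofNat, map_zero]; exact h
  let S : Subfield K := (algebraMap F K).fieldRange
  have mem : ∀ c : F, algebraMap F K c ∈ S := fun c => ⟨c, rfl⟩
  have m1 : l1 ∈ S := e1 ▸ S.pow_mem (mem c1) 4
  have m2 : l2 ∈ S := e2 ▸ S.pow_mem (mem c2) 4
  have m3 : l3 ∈ S := e3 ▸ S.pow_mem (mem c3) 4
  have Hs : s ∈ S := ciani_aux S h20 r s t α β γ l1 l2 l3 _ _ hr hs ht hΔ hα hβ hγ
    hd1 hd2 hd3 hl1 hl2 hl3 m1 (mem c2) (mem c3) e2 e3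
  have Ht : t ∈ S := ciani_aux S h20 s t r β γ α l2 l3 l1 _ _ hs ht hr
    (by convert hΔ using 1; ring) hβ hγ hα
    hd2 hd3 hd1 hl2 hl3 hl1 m2 (mem c3) (mem c1) e3 e1
  have Hr : r ∈ S := ciani_aux S h20 t r s γ α β l3 l1 l2 _ _ ht hr hs
    (by convert hΔ using 1; ring) hγ hα hβ
    hd3 hd1 hd2 hl3 hl1 hl2 m3 (mem c1) (mem c2) e1 e2
  exact ⟨Hr, Hs, Ht⟩
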